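/- Missing branch extension (circle-map criterion): let 1 ≤ i₀ ≤ n and suppose C¹ expanding branches f_i on I_i are given for all i ≠ i₀ satisfying Σ_{i≠i₀} 1/(f_i'(f_i⁻¹(x))) < 1 for every x ∈ [0,1], and let f_{i₀} be the unique C¹ expanding branch on I_{i₀} making the full branch map f Lebesgue-measure preserving. Then f represents a C¹ uniformly expanding circle map of degree n — i.e., with the cyclic convention that index n+1 means 1 and that matching at the point aₙ = 1 ≡ a₀ = 0 means fₙ'(1) = f₁'(0), the derivative matching f_i'(a_i) = f_{i+1}'(a_i) holds for every i ∈ {1, …, n} — if and only if all three of the following hold: (i) f_i'(a_i) = f_{i+1}'(a_i) for every i (cyclically) such that both i ≠ i₀ and i+1 ≠ i₀; (ii) f_{i₀−1}'(a_{i₀−1}) = ( 1 − Σ_{i≠i₀} 1/f_i'(a_{i−1}) )⁻¹; and (iii) f_{i₀+1}'(a_{i₀}) = ( 1 − Σ_{i≠i₀} 1/f_i'(a_i) )⁻¹, where in (ii) the index i₀−1 is replaced by n if i₀ = 1 and in (iii) the index i₀+1 is replaced by 1 if i₀ = n. -/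

import Mathlib

open Set MeasureTheory

/-- `g` (with derivative `g'`) is a C¹ expanding branch on the interval `[l, r]`. -/
def IsBranch (l r : ℝ) (g g' : ℝ → ℝ) : Prop :=
  (∀ x ∈ Set.Icc l r, HasDerivWithinAt g (g' x) (Set.Icc l r) x) ∧
  ContinuousOn g' (Set.Icc l r) ∧
  (∀ x ∈ Set.Icc l r, 1 < g' x) ∧
  g l = 0 ∧ g r = 1

/-- `F` is the full branch map associated to the branches `f i` on the partition `a`. -/
def AgreesWith {n : ℕ} (a : Fin (n + 1) → ℝ) (f : Fin n → ℝ → ℝ) (F : ℝ → ℝ) : Prop :=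
  (∀ i : Fin n, ∀ x ∈ Set.Ico (a i.castSucc) (a i.succ), F x = f i x) ∧ F 1 = 1

/-- `F` preserves Lebesgue measure on `[0,1]`. -/
def PreservesLeb (F : ℝ → ℝ) : Prop :=
  ∀ A : Set ℝ, MeasurableSet A → A ⊆ Set.Icc 0 1 →
    volume (F ⁻¹' A ∩ Set.Icc 0 1) = volume A

open Filter Topology in
theorem HasDerivWithinAt.of_local_left_inverse {f g : ℝ → ℝ} {f' a : ℝ} {s t : Set ℝ}
    (hg : Tendsto g (𝓝[s] a) (𝓝[t] (g a))) (hf : HasDerivWithinAt f f' t (g a)) (hf' : f' ≠ 0)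
    (ha : a ∈ s) (hfg : ∀ᶠ x in 𝓝[s] a, f (g x) = x) : HasDerivWithinAt g f'⁻¹ s a :=
  HasFDerivWithinAt.of_local_left_inverse
    (f' := ContinuousLinearEquiv.unitsEquivAut ℝ (Units.mk0 f' hf')) hg hf ha hfg

namespace IsBranch

variable {l r : ℝ} {g g' h : ℝ → ℝ}

theorem continuousOn (hb : IsBranch l r g g') : ContinuousOn g (Icc l r) :=
  fun x hx => (hb.1 x hx).continuousWithinAt

theorem sub_le_sub (hb : IsBranch l r g g') {x y : ℝ} (hx : x ∈ Icc l r) (hy : y ∈ Icc l r)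
    (hxy : x ≤ y) : y - x ≤ g y - g x := by
  have hd : ∀ z ∈ interior (Icc l r), HasDerivAt g (g' z) z := fun z hz =>
    (hb.1 z (interior_subset hz)).hasDerivAt (mem_interior_iff_mem_nhds.1 hz)
  have := (convex_Icc l r).mul_sub_le_image_sub_of_le_deriv (C := 1) hb.continuousOn
    (fun z hz => (hd z hz).differentiableAt.differentiableWithinAt)
    (fun z hz => (hd z hz).deriv ▸ (hb.2.2.1 z (interior_subset hz)).le) x hx y hy hxy
  rwa [one_mul] at this

theorem strictMonoOn (hb : IsBranch l r g g') : StrictMonoOn g (Icc l r) := by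
  intro x hx y hy hxy
  linarith [hb.sub_le_sub hx hy hxy.le]

theorem exists_rightInverse (hb : IsBranch l r g g') (hlr : l ≤ r) :
    ∃ h : ℝ → ℝ, ∀ x ∈ Icc (0 : ℝ) 1, h x ∈ Icc l r ∧ g (h x) = x := by
  have hsurj := intermediate_value_Icc hlr hb.continuousOn
  rw [hb.2.2.2.1, hb.2.2.2.2] at hsurj
  choose! h hh using fun x (hx : x ∈ Icc (0 : ℝ) 1) => hsurj hx
  exact ⟨h, hh⟩

theorem abs_rightInverse_sub_le (hb : IsBranch l r g g')
    (hh : ∀ x ∈ Icc (0 : ℝ) 1, h x ∈ Icc l r ∧ g (h x) = x) {x y : ℝ}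
    (hx : x ∈ Icc (0 : ℝ) 1) (hy : y ∈ Icc (0 : ℝ) 1) : |h x - h y| ≤ |x - y| := by
  obtain ⟨hx1, hx2⟩ := hh x hx
  obtain ⟨hy1, hy2⟩ := hh y hy
  rcases le_total (h x) (h y) with hle | hle
  · have := hb.sub_le_sub hx1 hy1 hle
    rw [abs_sub_comm, abs_of_nonneg (sub_nonneg.2 hle), abs_sub_comm]
    exact (by linarith : h y - h x ≤ y - x).trans (le_abs_self _)
  · have := hb.sub_le_sub hy1 hx1 hle
    rw [abs_of_nonneg (sub_nonneg.2 hle)]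
    exact (by linarith : h x - h y ≤ x - y).trans (le_abs_self _)

theorem hasDerivWithinAt_rightInverse (hb : IsBranch l r g g')
    (hh : ∀ x ∈ Icc (0 : ℝ) 1, h x ∈ Icc l r ∧ g (h x) = x) {x : ℝ} (hx : x ∈ Icc (0 : ℝ) 1) :
    HasDerivWithinAt h (g' (h x))⁻¹ (Icc 0 1) x := by
  have hcont : ContinuousOn h (Icc 0 1) :=
    (LipschitzOnWith.of_dist_le_mul (K := 1) fun x hx y hy => by
      simpa [Real.dist_eq] using hb.abs_rightInverse_sub_le hh hx hy).continuousOn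
  refine HasDerivWithinAt.of_local_left_inverse (t := Icc l r) ?_ (hb.1 _ (hh x hx).1)
    (by linarith [hb.2.2.1 _ (hh x hx).1]) hx ?_
  · exact (hcont x hx).tendsto_nhdsWithin fun y hy => (hh y hy).1
  · filter_upwards [self_mem_nhdsWithin] with y hy using (hh y hy).2

end IsBranch

theorem exists_mem_Ico_castSucc_succ {m : ℕ} (a : Fin (m + 1) → ℝ) {y : ℝ} (h0 : a 0 ≤ y)
    (h1 : y < a (Fin.last m)) : ∃ i : Fin m, y ∈ Ico (a i.castSucc) (a i.succ) := by
  have key : ∀ k : Fin (m + 1), y < a k → ∃ i : Fin m, y ∈ Ico (a i.castSucc) (a i.succ) := by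
    intro k
    induction k using Fin.induction with
    | zero => exact fun h => absurd h0 h.not_ge
    | succ i ih =>
      intro h
      by_cases hi : y < a i.castSucc
      · exact ih hi
      · exact ⟨i, not_lt.1 hi, h⟩
  exact key _ h1

theorem eq_of_mem_Ico_castSucc_succ {m : ℕ} {a : Fin (m + 1) → ℝ} (ha : StrictMono a) {y : ℝ}
    {i j : Fin m} (hi : y ∈ Ico (a i.castSucc) (a i.succ))
    (hj : y ∈ Ico (a j.castSucc) (a j.succ)) : i = j := by
  have h1 := ha.lt_iff_lt.1 (hi.1.trans_lt hj.2)
  have h2 := ha.lt_iff_lt.1 (hj.1.trans_lt hi.2)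
  rw [Fin.castSucc_lt_succ_iff] at h1 h2
  exact le_antisymm h1 h2

theorem exists_agreesWith {m : ℕ} {a : Fin (m + 1) → ℝ} (ha : StrictMono a)
    (hm : a (Fin.last m) = 1) (f : Fin m → ℝ → ℝ) : ∃ F, AgreesWith a f F := by
  classical
  refine ⟨fun x => if h : ∃ i : Fin m, x ∈ Ico (a i.castSucc) (a i.succ) then f h.choose x else 1,
    fun i x hx => ?_, ?_⟩
  · have h : ∃ i : Fin m, x ∈ Ico (a i.castSucc) (a i.succ) := ⟨i, hx⟩
    simp only [dif_pos h, eq_of_mem_Ico_castSucc_succ ha h.choose_spec hx]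
  · refine dif_neg ?_
    rintro ⟨i, hi⟩
    exact (hi.2.trans_le (ha.monotone (Fin.le_last _))).ne hm.symm

section FullBranch

variable {m : ℕ} {a : Fin (m + 1) → ℝ} {f f' h : Fin m → ℝ → ℝ} {F : ℝ → ℝ}

theorem AgreesWith.preimage_Ico_inter_Icc (ha0 : a 0 = 0) (ha1 : a (Fin.last m) = 1)
    (ha : StrictMono a) (hF : AgreesWith a f F)
    (hb : ∀ i, IsBranch (a i.castSucc) (a i.succ) (f i) (f' i))
    (hh : ∀ i, ∀ x ∈ Icc (0 : ℝ) 1, h i x ∈ Icc (a i.castSucc) (a i.succ) ∧ f i (h i x) = x)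
    {x : ℝ} (hx : x ∈ Icc (0 : ℝ) 1) :
    F ⁻¹' Ico 0 x ∩ Icc 0 1 = ⋃ i, Ico (a i.castSucc) (h i x) := by
  ext y
  simp only [mem_inter_iff, mem_preimage, mem_iUnion]
  constructor
  · rintro ⟨hy, hy01⟩
    have hy1 : y < 1 := by
      refine lt_of_le_of_ne hy01.2 ?_
      rintro rfl
      rw [hF.2] at hy
      exact (hy.2.trans_le hx.2).false
    obtain ⟨i, hi⟩ := exists_mem_Ico_castSucc_succ a (ha0.trans_le hy01.1) (hy1.trans_eq ha1.symm)
    rw [hF.1 i y hi] at hy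
    obtain ⟨hm, hfx⟩ := hh i x hx
    exact ⟨i, hi.1, ((hb i).strictMonoOn.lt_iff_lt (Ico_subset_Icc_self hi) hm).1
      (hy.2.trans_eq hfx.symm)⟩
  · rintro ⟨i, hi⟩
    obtain ⟨hm, hfx⟩ := hh i x hx
    have hy : y ∈ Ico (a i.castSucc) (a i.succ) := ⟨hi.1, hi.2.trans_le hm.2⟩
    have hmono := (hb i).strictMonoOn
    have hl : a i.castSucc ∈ Icc (a i.castSucc) (a i.succ) :=
      left_mem_Icc.2 (ha i.castSucc_lt_succ).le
    rw [hF.1 i y hy]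
    refine ⟨⟨?_, ?_⟩, ?_, ?_⟩
    · rw [← (hb i).2.2.2.1]
      exact hmono.monotoneOn hl (Ico_subset_Icc_self hy) hy.1
    · exact (hmono (Ico_subset_Icc_self hy) hm hi.2).trans_eq hfx
    · exact ha0.symm.trans_le ((ha.monotone (Fin.zero_le _)).trans hy.1)
    · exact hy.2.le.trans ((ha.monotone (Fin.le_last _)).trans_eq ha1)

theorem PreservesLeb.sum_rightInverse_sub (ha0 : a 0 = 0) (ha1 : a (Fin.last m) = 1)
    (ha : StrictMono a) (hF : AgreesWith a f F) (hpres : PreservesLeb F)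
    (hb : ∀ i, IsBranch (a i.castSucc) (a i.succ) (f i) (f' i))
    (hh : ∀ i, ∀ x ∈ Icc (0 : ℝ) 1, h i x ∈ Icc (a i.castSucc) (a i.succ) ∧ f i (h i x) = x)
    {x : ℝ} (hx : x ∈ Icc (0 : ℝ) 1) : ∑ i, (h i x - a i.castSucc) = x := by
  have hvol := hpres (Ico 0 x) measurableSet_Ico
    (Ico_subset_Icc_self.trans (Icc_subset_Icc_right hx.2))
  rw [hF.preimage_Ico_inter_Icc ha0 ha1 ha hb hh hx, measure_iUnion ?_ fun _ => measurableSet_Ico,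
    tsum_fintype] at hvol
  · have hnn : ∀ i, 0 ≤ h i x - a i.castSucc := fun i => sub_nonneg.2 (hh i x hx).1.1
    simp only [Real.volume_Ico, sub_zero] at hvol
    rw [← ENNReal.ofReal_sum_of_nonneg fun i _ => hnn i] at hvol
    exact (ENNReal.ofReal_eq_ofReal_iff (Finset.sum_nonneg fun i _ => hnn i) hx.1).1 hvol
  · intro i j hij
    refine Set.disjoint_left.2 fun y hi hj => hij (eq_of_mem_Ico_castSucc_succ ha
      (y := y) ⟨hi.1, ?_⟩ ⟨hj.1, ?_⟩)
    · exact hi.2.trans_le (hh i x hx).1.2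
    · exact hj.2.trans_le (hh j x hx).1.2

/-- The transfer operator of a Lebesgue-preserving full branch map fixes the constant `1`. -/
theorem sum_inv_deriv_eq_one (ha0 : a 0 = 0) (ha1 : a (Fin.last m) = 1) (ha : StrictMono a)
    (hpres : ∀ F, AgreesWith a f F → PreservesLeb F)
    (hb : ∀ i, IsBranch (a i.castSucc) (a i.succ) (f i) (f' i)) {x : ℝ}
    (hx : x ∈ Icc (0 : ℝ) 1) {y : Fin m → ℝ}
    (hy : ∀ i, y i ∈ Icc (a i.castSucc) (a i.succ) ∧ f i (y i) = x) :
    ∑ i, (f' i (y i))⁻¹ = 1 := by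
  choose h hh using fun i => (hb i).exists_rightInverse (ha i.castSucc_lt_succ).le
  have hyh : ∀ i, h i x = y i := fun i =>
    (hb i).strictMonoOn.injOn (hh i x hx).1 (hy i).1 ((hh i x hx).2.trans (hy i).2.symm)
  obtain ⟨F, hF⟩ := exists_agreesWith ha ha1 f
  have hd : HasDerivWithinAt (fun z => ∑ i, (h i z - a i.castSucc)) (∑ i, (f' i (y i))⁻¹)
      (Icc 0 1) x :=
    HasDerivWithinAt.fun_sum fun i _ =>
      (hyh i ▸ (hb i).hasDerivWithinAt_rightInverse (hh i) hx).sub_const _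
  refine (uniqueDiffOn_Icc zero_lt_one x hx).eq_deriv _ hd
    ((hasDerivWithinAt_id x _).congr (fun z hz => ?_) ?_)
  · exact (hpres F hF).sum_rightInverse_sub ha0 ha1 ha hF hb hh hz
  · exact (hpres F hF).sum_rightInverse_sub ha0 ha1 ha hF hb hh hx

end FullBranch

/-- circle-map criterion: with `g` the unique Lebesgue-preserving
extension of the branches `f i`, `i ≠ i₀`, the full branch map represents a C¹
uniformly expanding circle map of degree `n` (cyclic derivative matching of all
consecutive branches, where index arithmetic in `Fin n` is cyclic) if and only
if (i) the given branches match at the endpoints not involving `i₀`,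
(ii) `f'_{i₀-1}` at its right endpoint equals `(1 - ∑_{i ≠ i₀} 1/fᵢ'(a_{i-1}))⁻¹`, and
(iii) `f'_{i₀+1}` at its left endpoint equals `(1 - ∑_{i ≠ i₀} 1/fᵢ'(a_i))⁻¹`. -/
theorem missing_branch_circle_criterion (n : ℕ)
    (a : Fin (n + 3) → ℝ) (ha : StrictMono a) (ha0 : a 0 = 0)
    (haN : a (Fin.last (n + 2)) = 1)
    (i₀ : Fin (n + 2)) (f f' : Fin (n + 2) → ℝ → ℝ)
    (hbranch : ∀ i : Fin (n + 2), i ≠ i₀ →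
      IsBranch (a i.castSucc) (a i.succ) (f i) (f' i))
    (hsum : ∀ x ∈ Set.Icc (0 : ℝ) 1, ∀ y : Fin (n + 2) → ℝ,
      (∀ i, i ≠ i₀ → y i ∈ Set.Icc (a i.castSucc) (a i.succ) ∧ f i (y i) = x) →
      ∑ i ∈ Finset.univ.erase i₀, 1 / f' i (y i) < 1)
    (g g' : ℝ → ℝ)
    (hg : IsBranch (a i₀.castSucc) (a i₀.succ) g g')
    (hpres : ∀ F : ℝ → ℝ, AgreesWith a (Function.update f i₀ g) F → PreservesLeb F) :
    (∀ i : Fin (n + 2),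
        Function.update f' i₀ g' i (a i.succ) =
        Function.update f' i₀ g' (i + 1) (a (i + 1).castSucc)) ↔
    ((∀ i : Fin (n + 2), i ≠ i₀ → i + 1 ≠ i₀ →
        f' i (a i.succ) = f' (i + 1) (a (i + 1).castSucc)) ∧
     f' (i₀ - 1) (a (i₀ - 1).succ) =
       (1 - ∑ i ∈ Finset.univ.erase i₀, 1 / f' i (a i.castSucc))⁻¹ ∧
     f' (i₀ + 1) (a (i₀ + 1).castSucc) =
       (1 - ∑ i ∈ Finset.univ.erase i₀, 1 / f' i (a i.succ))⁻¹) := by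
  have hb : ∀ i, IsBranch (a i.castSucc) (a i.succ) (Function.update f i₀ g i)
      (Function.update f' i₀ g' i) := by
    intro i
    rcases eq_or_ne i i₀ with rfl | hi
    · simpa using hg
    · simpa [hi] using hbranch i hi
  have hval : ∀ x ∈ Icc (0 : ℝ) 1, ∀ y : Fin (n + 2) → ℝ,
      (∀ i, y i ∈ Icc (a i.castSucc) (a i.succ) ∧ Function.update f i₀ g i (y i) = x) →
      (1 - ∑ i ∈ Finset.univ.erase i₀, 1 / f' i (y i))⁻¹ = g' (y i₀) := by
    intro x hx y hy
    have hsum1 := sum_inv_deriv_eq_one ha0 haN ha hpres hb hx hy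
    rw [← Finset.add_sum_erase _ _ (Finset.mem_univ i₀), Function.update_self] at hsum1
    have hcongr : ∑ i ∈ Finset.univ.erase i₀, (Function.update f' i₀ g' i (y i))⁻¹ =
        ∑ i ∈ Finset.univ.erase i₀, 1 / f' i (y i) :=
      Finset.sum_congr rfl fun i hi => by
        rw [Function.update_of_ne (Finset.ne_of_mem_erase hi), one_div]
    rw [hcongr] at hsum1
    rw [← eq_sub_of_add_eq hsum1, inv_inv]
  have hleft := hval 0 (by simp) (fun i => a i.castSucc) fun i =>
    ⟨left_mem_Icc.2 (ha i.castSucc_lt_succ).le, (hb i).2.2.2.1⟩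
  have hright := hval 1 (by simp) (fun i => a i.succ) fun i =>
    ⟨right_mem_Icc.2 (ha i.castSucc_lt_succ).le, (hb i).2.2.2.2⟩
  rw [hleft, hright]
  have hsub : i₀ - 1 ≠ i₀ := by simp
  have hadd : i₀ + 1 ≠ i₀ := by simp
  constructor
  · intro H
    refine ⟨fun i hi hi1 => by simpa [hi, hi1] using H i, ?_, ?_⟩
    · have := H (i₀ - 1)
      rwa [sub_add_cancel, Function.update_self, Function.update_of_ne hsub] at this
    · have := H i₀
      rw [Function.update_self, Function.update_of_ne hadd] at this
      exact this.symm
  · rintro ⟨hmatch, hl, hr⟩ i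
    rcases eq_or_ne i i₀ with rfl | hi
    · rw [Function.update_self, Function.update_of_ne hadd, hr]
    · rcases eq_or_ne (i + 1) i₀ with rfl | hi1
      · rw [Function.update_self, Function.update_of_ne hi]
        rwa [add_sub_cancel_right] at hl
      · rw [Function.update_of_ne hi, Function.update_of_ne hi1]
        exact hmatch i hi hi1
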